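/- For every integer n ≥ 0 and all integers 0 ≤ i ≤ n and 0 ≤ j ≤ n+1: ∫_{B₂} x·Q_n^i(x,y)·Q_{n+1}^j(x,y) dx dy = a_{i,n} if j = i, and = 0 otherwise (i.e., the matrix A_{n,1} is diagonal with entries a_{i,n}). -/

import Mathlib

open MeasureTheory Real Filter

/-- The Gegenbauer polynomials `C_n^λ`, defined by their triple recursion. -/
noncomputable def gegenbauer (lam : ℝ) : ℕ → ℝ → ℝ
  | 0, _ => 1
  | 1, t => 2 * lam * t
  | (n + 2), t =>
      (2 * (((n : ℝ) + 1) + lam) / ((n : ℝ) + 2)) * t * gegenbauer lam (n + 1) t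
        - ((((n : ℝ) + 1) + 2 * lam - 1) / ((n : ℝ) + 2)) * gegenbauer lam n t

/-- The open unit disk in `ℝ²`. -/
def unitDisk : Set (ℝ × ℝ) := {p | p.1 ^ 2 + p.2 ^ 2 < 1}

/-- The normalization constant `h_{k,n}`. -/
noncomputable def hConst (k n : ℕ) : ℝ :=
  Real.sqrt ((π / 4 ^ k) * (Nat.factorial (n + k + 1)) /
    (((n : ℝ) + 1) * (2 * (k : ℝ) + 1) * ((Nat.factorial k : ℝ)) ^ 2 *
      (Nat.factorial (n - k) : ℝ)))

/-- The orthonormal polynomial basis `Q_n^k` on the unit disk. -/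
noncomputable def Q2 (n k : ℕ) (x y : ℝ) : ℝ :=
  (1 / hConst k n) * gegenbauer ((k : ℝ) + 1) (n - k) x *
    (1 - x ^ 2) ^ ((k : ℝ) / 2) * gegenbauer (1 / 2) k (y / Real.sqrt (1 - x ^ 2))

/-- The recursion coefficient `a_{k,n}`. -/
noncomputable def aCoef (k n : ℤ) : ℝ :=
  (1 / 2) * Real.sqrt (((n : ℝ) - k + 1) * ((n : ℝ) + k + 2) /
    (((n : ℝ) + 1) * ((n : ℝ) + 2)))

/-- The recursion coefficient `d_{k,n}`. -/
noncomputable def dCoef (k n : ℤ) : ℝ :=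
  (((k : ℝ) + 1) / 2) * Real.sqrt (((n : ℝ) + k + 3) * ((n : ℝ) + k + 2) /
    ((2 * (k : ℝ) + 1) * (2 * (k : ℝ) + 3) * ((n : ℝ) + 1) * ((n : ℝ) + 2)))

/-- The recursion coefficient `c_{k,n}`. -/
noncomputable def cCoef (k n : ℤ) : ℝ :=
  -((k : ℝ) / 2) * Real.sqrt (((n : ℝ) - k + 1) * ((n : ℝ) - k + 2) /
    (((n : ℝ) + 1) * ((n : ℝ) + 2) * (2 * (k : ℝ) - 1) * (2 * (k : ℝ) + 1)))

open Polynomial in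
/-- The Gegenbauer polynomials as elements of `ℝ[X]`. -/
noncomputable def gegenbauerPoly (lam : ℝ) : ℕ → ℝ[X]
  | 0 => 1
  | 1 => C (2 * lam) * X
  | (n + 2) =>
      C (2 * (((n : ℝ) + 1) + lam) / ((n : ℝ) + 2)) * X * gegenbauerPoly lam (n + 1)
        - C ((((n : ℝ) + 1) + 2 * lam - 1) / ((n : ℝ) + 2)) * gegenbauerPoly lam n

theorem eval_gegenbauerPoly (lam : ℝ) (n : ℕ) (t : ℝ) :
    (gegenbauerPoly lam n).eval t = gegenbauer lam n t := by
  induction n using Nat.twoStepInduction with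
  | zero => simp [gegenbauerPoly, gegenbauer]
  | one => simp [gegenbauerPoly, gegenbauer]
  | more n ih1 ih2 => simp [gegenbauerPoly, gegenbauer, ih1, ih2]

theorem continuous_gegenbauer (lam : ℝ) (n : ℕ) : Continuous (gegenbauer lam n) := by
  simpa only [eval_gegenbauerPoly] using (gegenbauerPoly lam n).continuous

theorem gegenbauer_add_two (lam : ℝ) (n : ℕ) (t : ℝ) :
    ((n : ℝ) + 2) * gegenbauer lam (n + 2) t =
      2 * (n + 1 + lam) * t * gegenbauer lam (n + 1) t - (n + 2 * lam) * gegenbauer lam n t := by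
  have : (n : ℝ) + 2 ≠ 0 := by positivity
  rw [gegenbauer]
  field_simp
  ring

theorem differentiable_gegenbauer (lam : ℝ) (n : ℕ) : Differentiable ℝ (gegenbauer lam n) := by
  simpa only [eval_gegenbauerPoly] using (gegenbauerPoly lam n).differentiable

theorem differentiable_deriv_gegenbauer (lam : ℝ) (n : ℕ) :
    Differentiable ℝ (deriv (gegenbauer lam n)) := by
  have : deriv (gegenbauer lam n) = fun t ↦ (gegenbauerPoly lam n).derivative.eval t := by
    funext t
    rw [← (gegenbauerPoly lam n).deriv]
    simp only [eval_gegenbauerPoly]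
  rw [this]
  exact (gegenbauerPoly lam n).derivative.differentiable

theorem deriv_gegenbauer_add_two (lam : ℝ) (n : ℕ) (t : ℝ) :
    ((n : ℝ) + 2) * deriv (gegenbauer lam (n + 2)) t =
      2 * (n + 1 + lam) * (gegenbauer lam (n + 1) t + t * deriv (gegenbauer lam (n + 1)) t)
        - (n + 2 * lam) * deriv (gegenbauer lam n) t := by
  have h0 := (differentiable_gegenbauer lam n t).hasDerivAt
  have h1 := (differentiable_gegenbauer lam (n + 1) t).hasDerivAt
  have h2 := (differentiable_gegenbauer lam (n + 2) t).hasDerivAt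
  have e := (((hasDerivAt_id t).const_mul (2 * (n + 1 + lam))).mul h1).sub
    (h0.const_mul (n + 2 * lam))
  have e2 := h2.const_mul ((n : ℝ) + 2)
  have := e2.unique (e.congr_of_eventuallyEq (.of_forall fun x ↦ gegenbauer_add_two lam n x))
  rw [this]
  simp only [id]
  ring

theorem deriv_gegenbauer_relations (lam : ℝ) (n : ℕ) (t : ℝ) :
    deriv (gegenbauer lam (n + 1)) t =
      (n + 2 * lam) * gegenbauer lam n t + t * deriv (gegenbauer lam n) t ∧
    deriv (gegenbauer lam n) t =
      t * deriv (gegenbauer lam (n + 1)) t - (n + 1) * gegenbauer lam (n + 1) t := by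
  induction n with
  | zero =>
    have h0 : gegenbauer lam 0 = fun _ ↦ 1 := by funext x; rw [gegenbauer]
    have h1 : gegenbauer lam 1 = fun x ↦ 2 * lam * x := by funext x; rw [gegenbauer]
    have hd : deriv (fun x ↦ 2 * lam * x) t = 2 * lam := by simp
    simp only [zero_add, h0, h1, hd, deriv_const, Nat.cast_zero]
    constructor <;> ring
  | succ n ih =>
    obtain ⟨ha, hb⟩ := ih
    have hr := gegenbauer_add_two lam n t
    have hd := deriv_gegenbauer_add_two lam n t
    have hn : (n : ℝ) + 2 ≠ 0 := by positivity
    have hc : deriv (gegenbauer lam (n + 2)) t =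
        (n + 1 + 2 * lam) * gegenbauer lam (n + 1) t + t * deriv (gegenbauer lam (n + 1)) t := by
      apply mul_left_cancel₀ hn
      rw [hd, hb]
      ring
    push_cast
    refine ⟨hc, ?_⟩
    rw [show n + 1 + 1 = n + 2 from rfl, hc]
    linear_combination hr + ha + t * hb

theorem deriv_deriv_gegenbauer (lam : ℝ) (n : ℕ) (t : ℝ) :
    (1 - t ^ 2) * deriv (deriv (gegenbauer lam n)) t =
      (2 * lam + 1) * t * deriv (gegenbauer lam n) t - n * (n + 2 * lam) * gegenbauer lam n t := by
  cases n with
  | zero =>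
    have h0 : gegenbauer lam 0 = fun _ ↦ 1 := by funext x; rw [gegenbauer]
    simp [h0]
  | succ n =>
    have h0 := (differentiable_gegenbauer lam n t).hasDerivAt
    have h1 := (differentiable_gegenbauer lam (n + 1) t).hasDerivAt
    have h2 := (differentiable_deriv_gegenbauer lam (n + 1) t).hasDerivAt
    have key : ∀ x, (1 - x ^ 2) * deriv (gegenbauer lam (n + 1)) x =
        (-(n + 1) * x) * gegenbauer lam (n + 1) x + (n + 2 * lam) * gegenbauer lam n x := by
      intro x
      obtain ⟨ha, hb⟩ := deriv_gegenbauer_relations lam n x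
      linear_combination ha + x * hb
    have e1 := (((hasDerivAt_id t).pow 2).const_sub 1).mul h2
    have e2 := (((hasDerivAt_id t).const_mul (-((n : ℝ) + 1))).mul h1).add
      (h0.const_mul (n + 2 * lam))
    have e := e1.unique (e2.congr_of_eventuallyEq (.of_forall key))
    obtain ⟨-, hb⟩ := deriv_gegenbauer_relations lam n t
    simp only [id, Pi.pow_apply] at e
    push_cast at e ⊢
    linear_combination e + (n + 2 * lam) * hb

theorem continuous_one_sub_sq_rpow {r : ℝ} (hr : 0 ≤ r) :
    Continuous fun x : ℝ ↦ (1 - x ^ 2) ^ r :=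
  (by fun_prop : Continuous fun x : ℝ ↦ 1 - x ^ 2).rpow_const fun _ ↦ Or.inr hr

theorem hasDerivAt_one_sub_sq_rpow (r : ℝ) {x : ℝ} (hx : x ∈ Set.Ioo (-1 : ℝ) 1) :
    HasDerivAt (fun x : ℝ ↦ (1 - x ^ 2) ^ (r + 1)) (-2 * (r + 1) * x * (1 - x ^ 2) ^ r) x := by
  have hp : 0 < 1 - x ^ 2 := by nlinarith [hx.1, hx.2]
  have h := ((hasDerivAt_pow 2 x).const_sub 1).rpow_const (p := r + 1) (Or.inl hp.ne')
  convert h using 1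
  rw [add_sub_cancel_right]
  push_cast
  ring

theorem integral_gegenbauer_mul_eq_zero {lam : ℝ} (hlam : 1 / 2 ≤ lam) {m n : ℕ} (h : m ≠ n) :
    ∫ x in (-1 : ℝ)..1, (1 - x ^ 2) ^ (lam - 1 / 2) * (gegenbauer lam m x * gegenbauer lam n x)
      = 0 := by
  set r := lam - 1 / 2 with hr
  have hr0 : 0 ≤ r := by linarith
  have cm := continuous_gegenbauer lam m
  have cn := continuous_gegenbauer lam n
  have cm' := (differentiable_deriv_gegenbauer lam m).continuous
  have cn' := (differentiable_deriv_gegenbauer lam n).continuous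
  have cw := continuous_one_sub_sq_rpow hr0
  have cw' := continuous_one_sub_sq_rpow (r := r + 1) (by linarith)
  set c : ℝ := n * (n + 2 * lam) - m * (m + 2 * lam) with hc
  have hc0 : c ≠ 0 := by
    have : c = ((n : ℝ) - m) * (n + m + 2 * lam) := by rw [hc]; ring
    rw [this]
    refine mul_ne_zero (sub_ne_zero.2 (by exact_mod_cast h.symm)) ?_
    positivity
  have hd : ∀ x ∈ Set.Ioo (-1 : ℝ) 1, HasDerivAt
      (fun x ↦ (1 - x ^ 2) ^ (r + 1) * (deriv (gegenbauer lam m) x * gegenbauer lam n x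
        - deriv (gegenbauer lam n) x * gegenbauer lam m x))
      (c * ((1 - x ^ 2) ^ r * (gegenbauer lam m x * gegenbauer lam n x))) x := by
    intro x hx
    have hp : 0 < 1 - x ^ 2 := by nlinarith [hx.1, hx.2]
    have hm := (differentiable_gegenbauer lam m x).hasDerivAt
    have hn := (differentiable_gegenbauer lam n x).hasDerivAt
    have hm2 := (differentiable_deriv_gegenbauer lam m x).hasDerivAt
    have hn2 := (differentiable_deriv_gegenbauer lam n x).hasDerivAt
    refine ((hasDerivAt_one_sub_sq_rpow r hx).mul
      ((hm2.mul hn).sub (hn2.mul hm))).congr_deriv ?_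
    simp only [Pi.sub_apply, Pi.mul_apply]
    rw [Real.rpow_add_one hp.ne']
    have om := deriv_deriv_gegenbauer lam m x
    have on := deriv_deriv_gegenbauer lam n x
    have hl : r + 1 = lam + 1 / 2 := by rw [hr]; ring
    rw [hl, hc]
    linear_combination (1 - x ^ 2) ^ r * (gegenbauer lam n x * om - gegenbauer lam m x * on)
  have hi := intervalIntegral.integral_eq_sub_of_hasDerivAt_of_le (by norm_num : (-1 : ℝ) ≤ 1)
    (Continuous.continuousOn (by fun_prop)) hd (Continuous.intervalIntegrable (by fun_prop) _ _)
  rw [intervalIntegral.integral_const_mul] at hi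
  have hz : (0 : ℝ) ^ (r + 1) = 0 := Real.zero_rpow (by linarith)
  norm_num [hz] at hi
  exact hi.resolve_left hc0

/-- The squared norm of `gegenbauer lam m` for the weight `(1 - x ^ 2) ^ (lam - 1 / 2)`. -/
noncomputable def gegenbauerNormSq (lam : ℝ) (m : ℕ) : ℝ :=
  ∫ x in (-1 : ℝ)..1, (1 - x ^ 2) ^ (lam - 1 / 2) * (gegenbauer lam m x * gegenbauer lam m x)

theorem integral_id_mul_gegenbauer_mul {lam : ℝ} (hlam : 1 / 2 ≤ lam) (m : ℕ) :
    2 * (m + lam) * ∫ x in (-1 : ℝ)..1, (1 - x ^ 2) ^ (lam - 1 / 2) *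
      (x * gegenbauer lam m x * gegenbauer lam (m + 1) x) =
        (m + 1) * gegenbauerNormSq lam (m + 1) := by
  have cw := continuous_one_sub_sq_rpow (r := lam - 1 / 2) (by linarith)
  have cg := continuous_gegenbauer lam
  rw [gegenbauerNormSq, ← intervalIntegral.integral_const_mul,
    ← intervalIntegral.integral_const_mul]
  cases m with
  | zero =>
    congr 1
    funext x
    simp only [gegenbauer]
    push_cast
    ring
  | succ m =>
    have ho := integral_gegenbauer_mul_eq_zero hlam (show m ≠ m + 2 by omega)
    rw [← sub_eq_zero, ← intervalIntegral.integral_sub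
      (Continuous.intervalIntegrable (by fun_prop) _ _)
      (Continuous.intervalIntegrable (by fun_prop) _ _),
      ← mul_zero (m + 2 * lam), ← ho, ← intervalIntegral.integral_const_mul]
    congr 1
    funext x
    push_cast
    linear_combination -(1 - x ^ 2) ^ (lam - 1 / 2) * gegenbauer lam (m + 2) x *
      gegenbauer_add_two lam m x

theorem integral_id_mul_gegenbauer_mul' {lam : ℝ} (hlam : 1 / 2 ≤ lam) (m : ℕ) :
    2 * (m + 1 + lam) * ∫ x in (-1 : ℝ)..1, (1 - x ^ 2) ^ (lam - 1 / 2) *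
      (x * gegenbauer lam m x * gegenbauer lam (m + 1) x) =
        (m + 2 * lam) * gegenbauerNormSq lam m := by
  have cw := continuous_one_sub_sq_rpow (r := lam - 1 / 2) (by linarith)
  have cg := continuous_gegenbauer lam
  have ho := integral_gegenbauer_mul_eq_zero hlam (show m ≠ m + 2 by omega)
  rw [gegenbauerNormSq, ← intervalIntegral.integral_const_mul,
    ← intervalIntegral.integral_const_mul, ← sub_eq_zero, ← intervalIntegral.integral_sub
      (Continuous.intervalIntegrable (by fun_prop) _ _)
      (Continuous.intervalIntegrable (by fun_prop) _ _),
      ← mul_zero ((m : ℝ) + 2), ← ho, ← intervalIntegral.integral_const_mul]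
  congr 1
  funext x
  linear_combination -(1 - x ^ 2) ^ (lam - 1 / 2) * gegenbauer lam m x * gegenbauer_add_two lam m x

theorem gegenbauerNormSq_succ {lam : ℝ} (hlam : 1 / 2 ≤ lam) (m : ℕ) :
    (m + 1) * (m + 1 + lam) * gegenbauerNormSq lam (m + 1) =
      (m + 2 * lam) * (m + lam) * gegenbauerNormSq lam m := by
  linear_combination (m + lam) * integral_id_mul_gegenbauer_mul' hlam m -
    (m + 1 + lam) * integral_id_mul_gegenbauer_mul hlam m

theorem gegenbauerNormSq_half (m : ℕ) : (2 * m + 1) * gegenbauerNormSq (1 / 2) m = 2 := by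
  induction m with
  | zero => simp [gegenbauerNormSq, gegenbauer]; norm_num
  | succ m ih =>
    have h := gegenbauerNormSq_succ (le_refl (1 / 2)) m
    have hm : (m : ℝ) + 1 ≠ 0 := by positivity
    apply mul_left_cancel₀ hm
    push_cast
    linear_combination 2 * h + (m + 1) * ih

theorem integral_one_sub_sq_rpow_succ {r : ℝ} (hr : 0 ≤ r) :
    (2 * r + 3) * ∫ x in (-1 : ℝ)..1, (1 - x ^ 2) ^ (r + 1) =
      (2 * r + 2) * ∫ x in (-1 : ℝ)..1, (1 - x ^ 2) ^ r := by
  have cw := continuous_one_sub_sq_rpow hr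
  have cw' := continuous_one_sub_sq_rpow (r := r + 1) (by linarith)
  have hd : ∀ x ∈ Set.Ioo (-1 : ℝ) 1, HasDerivAt (fun x ↦ x * (1 - x ^ 2) ^ (r + 1))
      ((2 * r + 3) * (1 - x ^ 2) ^ (r + 1) - (2 * r + 2) * (1 - x ^ 2) ^ r) x := by
    intro x hx
    have hp : 0 < 1 - x ^ 2 := by nlinarith [hx.1, hx.2]
    refine ((hasDerivAt_id x).mul (hasDerivAt_one_sub_sq_rpow r hx)).congr_deriv ?_
    simp only [id]
    rw [Real.rpow_add_one hp.ne']
    ring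
  have hi := intervalIntegral.integral_eq_sub_of_hasDerivAt_of_le (by norm_num : (-1 : ℝ) ≤ 1)
    (Continuous.continuousOn (by fun_prop)) hd (Continuous.intervalIntegrable (by fun_prop) _ _)
  have hz : (0 : ℝ) ^ (r + 1) = 0 := Real.zero_rpow (by linarith)
  rw [intervalIntegral.integral_sub (Continuous.intervalIntegrable (by fun_prop) _ _)
    (Continuous.intervalIntegrable (by fun_prop) _ _), intervalIntegral.integral_const_mul,
    intervalIntegral.integral_const_mul] at hi
  norm_num [hz] at hi
  linarith

theorem integral_one_sub_sq_rpow_add_half (k : ℕ) :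
    ((k : ℝ) + 1) * (k.factorial : ℝ) ^ 2 * 2 * 4 ^ k *
      ∫ x in (-1 : ℝ)..1, (1 - x ^ 2) ^ ((k : ℝ) + 1 / 2) = π * (2 * k + 1).factorial := by
  induction k with
  | zero =>
    have : ∫ x in (-1 : ℝ)..1, (1 - x ^ 2) ^ ((0 : ℝ) + 1 / 2) = π / 2 := by
      rw [← integral_sqrt_one_sub_sq]
      simp only [Real.sqrt_eq_rpow, zero_add]
    rw [Nat.cast_zero, this]
    simp
    ring
  | succ k ih =>
    have h := integral_one_sub_sq_rpow_succ (r := (k : ℝ) + 1 / 2) (by positivity)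
    have hf : (2 * (k + 1) + 1).factorial = (2 * k + 3) * (2 * k + 2) * (2 * k + 1).factorial := by
      rw [show 2 * (k + 1) + 1 = 2 * k + 1 + 1 + 1 by ring, Nat.factorial_succ, Nat.factorial_succ]
      ring
    have he : ((k + 1 : ℕ) : ℝ) + 1 / 2 = (k : ℝ) + 1 / 2 + 1 := by push_cast; ring
    rw [hf, he, Nat.factorial_succ, pow_succ]
    push_cast
    linear_combination (2 * (k : ℝ) + 3) * (2 * k + 2) * ih +
      (k + 1) ^ 2 * (k.factorial : ℝ) ^ 2 * 4 * 4 ^ k * h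

theorem gegenbauerNormSq_nat (k m : ℕ) :
    gegenbauerNormSq ((k : ℝ) + 1) m * (2 * 4 ^ k * (k.factorial : ℝ) ^ 2 * (m + k + 1) *
      m.factorial) = π * (m + 2 * k + 1).factorial := by
  induction m with
  | zero =>
    have h := integral_one_sub_sq_rpow_add_half k
    have he : (k : ℝ) + 1 - 1 / 2 = k + 1 / 2 := by ring
    simp only [gegenbauerNormSq, gegenbauer, he, mul_one, Nat.factorial_zero, Nat.cast_zero,
      Nat.cast_one, zero_add]
    linear_combination h
  | succ m ih =>
    have h := gegenbauerNormSq_succ (lam := (k : ℝ) + 1)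
      (by have : (0 : ℝ) ≤ k := by positivity
          linarith) m
    rw [show m + 1 + 2 * k + 1 = m + 2 * k + 1 + 1 by ring, Nat.factorial_succ, Nat.factorial_succ]
    push_cast
    linear_combination (2 * 4 ^ k * (k.factorial : ℝ) ^ 2 * m.factorial) * h +
      (m + 2 * k + 2) * ih

theorem hConst_sq {k n : ℕ} (h : k ≤ n) :
    hConst k n ^ 2 = 2 / (2 * k + 1) * gegenbauerNormSq ((k : ℝ) + 1) (n - k) := by
  obtain ⟨m, rfl⟩ := Nat.exists_eq_add_of_le h
  have hg := gegenbauerNormSq_nat k m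
  rw [hConst, Real.sq_sqrt (by positivity), Nat.add_sub_cancel_left,
    show k + m + k + 1 = m + 2 * k + 1 by ring]
  have h1 : (k.factorial : ℝ) ≠ 0 := by positivity
  have h2 : (m.factorial : ℝ) ≠ 0 := by positivity
  have h3 : (k : ℝ) + m + 1 ≠ 0 := by positivity
  have h4 : 2 * (k : ℝ) + 1 ≠ 0 := by positivity
  push_cast
  field_simp
  linear_combination -hg

theorem hConst_pos (k n : ℕ) : 0 < hConst k n := by
  rw [hConst]
  exact Real.sqrt_pos.2 (by positivity)

theorem hConst_succ_sq {k n : ℕ} (h : k ≤ n) :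
    hConst k (n + 1) ^ 2 * ((n + 2) * (n - k + 1)) = hConst k n ^ 2 * ((n + k + 2) * (n + 1)) := by
  obtain ⟨m, rfl⟩ := Nat.exists_eq_add_of_le h
  rw [hConst, hConst, Real.sq_sqrt (by positivity), Real.sq_sqrt (by positivity),
    show k + m + 1 - k = m + 1 by omega, Nat.add_sub_cancel_left,
    show k + m + 1 + k + 1 = k + m + k + 1 + 1 by ring, Nat.factorial_succ (k + m + k + 1),
    Nat.factorial_succ m]
  have h2 : (m.factorial : ℝ) ≠ 0 := by positivity
  have h5 : (k : ℝ) + m + 1 + 1 ≠ 0 := by positivity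
  have h6 : (m : ℝ) + 1 ≠ 0 := by positivity
  push_cast
  field_simp
  ring

theorem measurableSet_unitDisk : MeasurableSet unitDisk :=
  (isOpen_lt (by fun_prop) continuous_const).measurableSet

theorem mem_unitDisk_iff (x y : ℝ) :
    (x, y) ∈ unitDisk ↔ x ∈ Set.Ioo (-1 : ℝ) 1 ∧ y ∈ Set.Ioo (-√(1 - x ^ 2)) (√(1 - x ^ 2)) := by
  simp only [unitDisk, Set.mem_ofPred_eq, Set.mem_Ioo, ← abs_lt, ← sq_lt_one_iff_abs_lt_one,
    Real.lt_sqrt (abs_nonneg y), sq_abs]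
  constructor
  · intro h
    constructor <;> nlinarith [sq_nonneg x, sq_nonneg y]
  · rintro ⟨-, h⟩
    linarith

theorem measure_unitDisk_lt_top : volume unitDisk < ⊤ := by
  refine (measure_mono (t := Set.Icc (-1 : ℝ × ℝ) 1) ?_).trans_lt isCompact_Icc.measure_lt_top
  intro p hp
  have hp : p.1 ^ 2 + p.2 ^ 2 < 1 := hp
  refine ⟨⟨?_, ?_⟩, ⟨?_, ?_⟩⟩ <;> simp <;> nlinarith [sq_nonneg p.1, sq_nonneg p.2]

theorem exists_bound_gegenbauer (lam : ℝ) (n : ℕ) :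
    ∃ B, ∀ x ∈ Set.Icc (-1 : ℝ) 1, ‖gegenbauer lam n x‖ ≤ B :=
  isCompact_Icc.exists_bound_of_continuousOn (continuous_gegenbauer lam n).continuousOn

theorem measurable_Q2 (n k : ℕ) : Measurable fun p : ℝ × ℝ ↦ Q2 n k p.1 p.2 := by
  have h1 := (continuous_gegenbauer ((k : ℝ) + 1) (n - k)).measurable
  have h2 := (continuous_gegenbauer (1 / 2) k).measurable
  unfold Q2
  fun_prop

theorem exists_bound_Q2 (n k : ℕ) : ∃ B, ∀ p ∈ unitDisk, ‖Q2 n k p.1 p.2‖ ≤ B := by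
  obtain ⟨B₁, h₁⟩ := exists_bound_gegenbauer ((k : ℝ) + 1) (n - k)
  obtain ⟨B₂, h₂⟩ := exists_bound_gegenbauer (1 / 2) k
  refine ⟨‖1 / hConst k n‖ * B₁ * 1 * B₂, fun p hp ↦ ?_⟩
  obtain ⟨hx, hy⟩ := (mem_unitDisk_iff p.1 p.2).1 hp
  have hp : 0 < 1 - p.1 ^ 2 := by nlinarith [hx.1, hx.2]
  have hs := Real.sqrt_pos.2 hp
  have b₁ := h₁ _ (Set.Ioo_subset_Icc_self hx)
  have b₂ := h₂ (p.2 / √(1 - p.1 ^ 2)) ⟨by rw [le_div_iff₀ hs]; linarith [hy.1],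
    by rw [div_le_iff₀ hs]; linarith [hy.2]⟩
  have b₃ : ‖(1 - p.1 ^ 2) ^ ((k : ℝ) / 2)‖ ≤ 1 := by
    rw [Real.norm_of_nonneg (by positivity)]
    exact Real.rpow_le_one hp.le (by nlinarith [sq_nonneg p.1]) (by positivity)
  have b₀ : 0 ≤ B₁ := (norm_nonneg _).trans b₁
  rw [Q2, norm_mul, norm_mul, norm_mul]
  gcongr

theorem integrableOn_unitDisk_mul_Q2 (n m i j : ℕ) :
    IntegrableOn (fun p : ℝ × ℝ ↦ p.1 * Q2 n i p.1 p.2 * Q2 m j p.1 p.2) unitDisk := by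
  obtain ⟨B₁, h₁⟩ := exists_bound_Q2 n i
  obtain ⟨B₂, h₂⟩ := exists_bound_Q2 m j
  have hm := (measurable_fst.mul (measurable_Q2 n i)).mul (measurable_Q2 m j)
  refine Measure.integrableOn_of_bounded (M := 1 * B₁ * B₂) measure_unitDisk_lt_top.ne
    hm.aestronglyMeasurable ?_
  filter_upwards [ae_restrict_mem measurableSet_unitDisk] with p hp
  have b₁ := h₁ p hp
  have b₂ := h₂ p hp
  have b₀ : 0 ≤ B₁ := (norm_nonneg _).trans b₁
  have hx := ((mem_unitDisk_iff p.1 p.2).1 hp).1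
  have b₃ : ‖p.1‖ ≤ 1 := abs_le.2 ⟨hx.1.le, hx.2.le⟩
  rw [norm_mul, norm_mul]
  gcongr

/-- Fubini on the disk. -/
theorem integral_unitDisk {f : ℝ × ℝ → ℝ} (hf : IntegrableOn f unitDisk) :
    ∫ p in unitDisk, f p =
      ∫ x in Set.Ioo (-1 : ℝ) 1, ∫ y in (-√(1 - x ^ 2))..√(1 - x ^ 2), f (x, y) := by
  rw [← integral_indicator measurableSet_unitDisk, Measure.volume_eq_prod,
    integral_prod _ (by
      rw [← Measure.volume_eq_prod]
      exact hf.integrable_indicator measurableSet_unitDisk),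
    ← integral_indicator measurableSet_Ioo]
  congr 1
  funext x
  by_cases hx : x ∈ Set.Ioo (-1 : ℝ) 1
  · rw [Set.indicator_of_mem hx, intervalIntegral.integral_of_le
      (neg_le_self (Real.sqrt_nonneg _)), integral_Ioc_eq_integral_Ioo,
      ← integral_indicator measurableSet_Ioo]
    congr 1
    funext y
    simp only [Set.indicator, mem_unitDisk_iff, hx, true_and]
  · rw [Set.indicator_of_notMem hx, ← integral_zero ℝ ℝ]
    congr 1
    funext y
    simp only [Set.indicator, mem_unitDisk_iff, hx, false_and, if_false]

theorem integral_legendre_mul (i j : ℕ) :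
    ∫ t in (-1 : ℝ)..1, gegenbauer (1 / 2) i t * gegenbauer (1 / 2) j t =
      if j = i then 2 / (2 * (i : ℝ) + 1) else 0 := by
  split_ifs with h
  · subst h
    have := gegenbauerNormSq_half j
    rw [gegenbauerNormSq, sub_self] at this
    simp only [Real.rpow_zero, one_mul] at this
    rw [eq_div_iff (by positivity), mul_comm, this]
  · simpa using integral_gegenbauer_mul_eq_zero (le_refl (1 / 2)) (Ne.symm h)

theorem integral_inner_Q2 (n m i j : ℕ) {x : ℝ} (hx : x ∈ Set.Ioo (-1 : ℝ) 1) :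
    ∫ y in (-√(1 - x ^ 2))..√(1 - x ^ 2), x * Q2 n i x y * Q2 m j x y =
      if j = i then 1 / (hConst i n * hConst i m) * (2 / (2 * (i : ℝ) + 1)) *
        ((1 - x ^ 2) ^ ((i : ℝ) + 1 / 2) * (x * gegenbauer ((i : ℝ) + 1) (n - i) x *
          gegenbauer ((i : ℝ) + 1) (m - i) x)) else 0 := by
  have hp : 0 < 1 - x ^ 2 := by nlinarith [hx.1, hx.2]
  have hs := Real.sqrt_pos.2 hp
  have e : ∀ y, x * Q2 n i x y * Q2 m j x y =
      (x * (1 / hConst i n * gegenbauer ((i : ℝ) + 1) (n - i) x * (1 - x ^ 2) ^ ((i : ℝ) / 2)) *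
        (1 / hConst j m * gegenbauer ((j : ℝ) + 1) (m - j) x * (1 - x ^ 2) ^ ((j : ℝ) / 2))) *
      (fun t ↦ gegenbauer (1 / 2) i t * gegenbauer (1 / 2) j t) (y / √(1 - x ^ 2)) := by
    intro y
    simp only [Q2]
    ring
  simp_rw [e]
  rw [intervalIntegral.integral_const_mul, intervalIntegral.integral_comp_div
    (fun t ↦ gegenbauer (1 / 2) i t * gegenbauer (1 / 2) j t) hs.ne',
    neg_div, div_self hs.ne', integral_legendre_mul]
  split_ifs with h
  · subst h
    have hw : (1 - x ^ 2) ^ ((j : ℝ) + 1 / 2) =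
        (1 - x ^ 2) ^ ((j : ℝ) / 2) * (1 - x ^ 2) ^ ((j : ℝ) / 2) * √(1 - x ^ 2) := by
      rw [Real.sqrt_eq_rpow, ← Real.rpow_add hp, ← Real.rpow_add hp]
      ring_nf
    rw [hw, smul_eq_mul, one_div_mul_eq_div, div_eq_mul_inv _ (hConst j n * _), mul_inv]
    ring
  · simp

/-- the matrix `A_{n,1}` is diagonal with entries `a_{i,n}`. -/
theorem A_n1_diagonal (n i j : ℕ) (hi : i ≤ n) (hj : j ≤ n + 1) :
    (∫ p in unitDisk, p.1 * Q2 n i p.1 p.2 * Q2 (n + 1) j p.1 p.2) =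
      if j = i then aCoef i n else 0 := by
  rw [integral_unitDisk (integrableOn_unitDisk_mul_Q2 n (n + 1) i j),
    setIntegral_congr_fun measurableSet_Ioo fun x hx ↦ integral_inner_Q2 n (n + 1) i j hx]
  split_ifs with h
  · have h0 := hConst_pos i n
    have h1 := hConst_pos i (n + 1)
    have hsq := hConst_succ_sq hi
    have hnorm := hConst_sq (hi.trans n.le_succ)
    obtain ⟨m, rfl⟩ := Nat.exists_eq_add_of_le hi
    have hI := integral_id_mul_gegenbauer_mul (lam := (i : ℝ) + 1)
      (by have : (0 : ℝ) ≤ i := by positivity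
          linarith) m
    rw [← integral_Ioc_eq_integral_Ioo, ← intervalIntegral.integral_of_le (by norm_num),
      intervalIntegral.integral_const_mul, Nat.add_sub_cancel_left,
      show i + m + 1 - i = m + 1 by omega]
    rw [show i + m + 1 - i = m + 1 by omega] at hnorm
    rw [show (i : ℝ) + 1 - 1 / 2 = i + 1 / 2 by ring] at hI
    set I := ∫ x in (-1 : ℝ)..1, (1 - x ^ 2) ^ ((i : ℝ) + 1 / 2) *
      (x * gegenbauer ((i : ℝ) + 1) m x * gegenbauer ((i : ℝ) + 1) (m + 1) x)
    have hratio : √(((i : ℝ) + m - i + 1) * (i + m + i + 2) / ((i + m + 1) * (i + m + 2))) =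
        hConst i (i + m + 1) / hConst i (i + m) * ((m + 1) / (i + m + 1)) := by
      rw [Real.sqrt_eq_iff_mul_self_eq (by rw [add_sub_cancel_left]; positivity) (by positivity)]
      push_cast at hsq
      rw [add_sub_cancel_left] at hsq ⊢
      field_simp
      linear_combination -hsq
    rw [aCoef]
    push_cast
    rw [hratio]
    have h4 : 2 * (i : ℝ) + 1 ≠ 0 := by positivity
    have h3 : (i : ℝ) + m + 1 ≠ 0 := by positivity
    field_simp at hnorm ⊢
    linear_combination 2 * hI - (m + 1) * hnorm
  · simp
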